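/- If G is a finite chordal graph, then γ(G) = γ^i(G), i.e., the domination number equals the independence-domination number. -/

import Mathlib

/-- `A` dominates `B` in `G`: every vertex of `B` lies in the closed
neighborhood of some vertex of `A`. -/
def Dominates {V : Type*} (G : SimpleGraph V) (A B : Finset V) : Prop :=
  ∀ b ∈ B, ∃ a ∈ A, a = b ∨ G.Adj a b

/-- `γ_G(B)`: the minimum cardinality of a set of vertices dominating `B`. -/
noncomputable def domNum {V : Type*} (G : SimpleGraph V) (B : Finset V) : ℕ :=
  sInf {n | ∃ A : Finset V, A.card = n ∧ Dominates G A B}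

/-- The domination number `γ(G)`. -/
noncomputable def gamma {V : Type*} [Fintype V] (G : SimpleGraph V) : ℕ :=
  domNum G Finset.univ

/-- `A` is an independent set in `G`. -/
def IndepIn {V : Type*} (G : SimpleGraph V) (A : Finset V) : Prop :=
  ∀ x ∈ A, ∀ y ∈ A, ¬ G.Adj x y

/-- The independence-domination number `γ^i(G)`. -/
noncomputable def gammaI {V : Type*} (G : SimpleGraph V) : ℕ :=
  sSup {n | ∃ A : Finset V, IndepIn G A ∧ domNum G A = n}

open SimpleGraph in
/-- A shortest walk from `x` to `y` with all vertices in `T`, listed as a sequence, is an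
induced path. -/
theorem exists_induced_path {V : Type*} (H : SimpleGraph V) {x y : V} (h : H.Reachable x y) :
    ∃ (n : ℕ) (p : ℕ → V), p 0 = x ∧ p n = y ∧
      (∀ i j, i ≤ n → j ≤ n → p i = p j → i = j) ∧
      (∀ i j, i ≤ n → j ≤ n → (H.Adj (p i) (p j) ↔ i = j + 1 ∨ j = i + 1)) := by
  obtain ⟨w, hw⟩ := h.exists_walk_length_eq_dist
  have hd : ∀ i, i ≤ w.length → H.dist x (w.getVert i) = i := by
    intro i hi
    have h1 : H.dist x (w.getVert i) ≤ i :=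
      (dist_le (w.take i)).trans (by simp)
    have h2 : H.dist (w.getVert i) y ≤ w.length - i :=
      (dist_le (w.drop i)).trans (by simp)
    have h3 := dist_le ((w.take i).append (w.drop i))
    have h4 : H.dist x y ≤ H.dist x (w.getVert i) + H.dist (w.getVert i) y := by
      obtain ⟨a, ha⟩ := (w.take i).reachable.exists_walk_length_eq_dist
      obtain ⟨b, hb⟩ := (w.drop i).reachable.exists_walk_length_eq_dist
      rw [← ha, ← hb, ← Walk.length_append]
      exact dist_le _
    omega
  have hstep : ∀ i j, i ≤ w.length → j ≤ w.length → H.Adj (w.getVert i) (w.getVert j) →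
      j ≤ i + 1 := by
    intro i j hi hj hadj
    obtain ⟨a, ha⟩ := (w.take i).reachable.exists_walk_length_eq_dist
    have h1 := dist_le (a.concat hadj)
    rw [Walk.length_concat, ha, hd i hi, hd j hj] at h1
    exact h1
  have hinj : ∀ i j, i ≤ w.length → j ≤ w.length → w.getVert i = w.getVert j → i = j := by
    intro i j hi hj hij
    rw [← hd i hi, hij, hd j hj]
  refine ⟨w.length, w.getVert, by simp, by simp, hinj, ?_⟩
  intro i j hi hj
  constructor
  · intro hadj
    have h1 := hstep i j hi hj hadj
    have h2 := hstep j i hj hi hadj.symm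
    have h3 : i ≠ j := by
      rintro rfl
      exact H.irrefl hadj
    omega
  · rintro (rfl | rfl)
    · exact (w.adj_getVert_succ (by omega)).symm
    · exact w.adj_getVert_succ (by omega)

/-- Closing up an induced path with a vertex adjacent to exactly its two ends yields an
induced cycle. -/
theorem exists_induced_cycle {V : Type*} (G : SimpleGraph V) (n : ℕ) (hn : 2 ≤ n) (p : ℕ → V)
    (v : V) (hinj : ∀ i j, i ≤ n → j ≤ n → p i = p j → i = j)
    (hadj : ∀ i j, i ≤ n → j ≤ n → (G.Adj (p i) (p j) ↔ i = j + 1 ∨ j = i + 1))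
    (hv : ∀ i, i ≤ n → p i ≠ v) (hvadj : ∀ i, i ≤ n → (G.Adj v (p i) ↔ i = 0 ∨ i = n)) :
    ∃ f : Fin (n + 2) ↪ V, ∀ a b : Fin (n + 2),
      G.Adj (f a) (f b) ↔ (SimpleGraph.cycleGraph (n + 2)).Adj a b := by
  have hf : Function.Injective fun a : Fin (n + 2) => if a.val ≤ n then p a.val else v := by
    intro a b hab
    ext
    have ha := a.isLt
    have hb := b.isLt
    dsimp only at hab
    split_ifs at hab with h1 h2 h2
    · exact hinj _ _ h1 h2 hab
    · exact absurd hab (hv _ h1)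
    · exact absurd hab.symm (hv _ h2)
    · omega
  refine ⟨⟨_, hf⟩, ?_⟩
  intro a b
  have ha := a.isLt
  have hb := b.isLt
  have hsub : ∀ c d : Fin (n + 2), (c - d).val = 1 ↔
      (c.val = d.val + 1 ∨ (c.val = 0 ∧ d.val = n + 1)) := by
    intro c d
    have hc := c.isLt
    have hd := d.isLt
    rw [Fin.sub_def]
    dsimp only
    rcases le_or_gt d.val c.val with h | h
    · have : n + 2 - d.val + c.val = (c.val - d.val) + (n + 2) := by omega
      rw [this, Nat.add_mod_right, Nat.mod_eq_of_lt (by omega)]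
      omega
    · rw [Nat.mod_eq_of_lt (by omega)]
      omega
  rw [SimpleGraph.cycleGraph_adj', hsub, hsub]
  rw [Function.Embedding.coeFn_mk]
  split_ifs with h1 h2 h2
  · rw [hadj _ _ h1 h2]
    omega
  · rw [G.adj_comm, hvadj _ h1]
    omega
  · rw [hvadj _ h2]
    omega
  · simp only [SimpleGraph.irrefl, false_iff]
    omega

/-- `u` is simplicial in the subgraph of `G` induced on `S`. -/
def SimplicialIn {V : Type*} (G : SimpleGraph V) (S : Finset V) (u : V) : Prop :=
  ∀ a ∈ S, ∀ b ∈ S, G.Adj u a → G.Adj u b → a ≠ b → G.Adj a b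

/-- No induced cycle of length at least four. -/
def NoLongInducedCycle {V : Type*} (G : SimpleGraph V) : Prop :=
  ∀ n : ℕ, 4 ≤ n → ¬ ∃ f : Fin n ↪ V, ∀ a b : Fin n,
    G.Adj (f a) (f b) ↔ (SimpleGraph.cycleGraph n).Adj a b

/-- In a chordal graph, two neighbours of `v` that are joined by a walk avoiding the closed
neighbourhood of `v` are adjacent. -/
theorem NoLongInducedCycle.adj_of_reachable {V : Type*} {G : SimpleGraph V}
    (hG : NoLongInducedCycle G) {v x y : V} (hvx : G.Adj v x) (hvy : G.Adj v y) (hxy : x ≠ y)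
    {T : Set V} (hT : ∀ t ∈ T, t = x ∨ t = y ∨ (t ≠ v ∧ ¬ G.Adj v t))
    {H : SimpleGraph V} (hH : ∀ a b, H.Adj a b ↔ G.Adj a b ∧ a ∈ T ∧ b ∈ T)
    (hr : H.Reachable x y) : G.Adj x y := by
  by_contra hnadj
  obtain ⟨n, p, hp0, hpn, hinj, hadj⟩ := exists_induced_path H hr
  have hn0 : n ≠ 0 := by
    rintro rfl
    exact hxy (hp0.symm.trans hpn)
  have hn1 : n ≠ 1 := by
    rintro rfl
    have := (hadj 0 1 (by omega) le_rfl).2 (by omega)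
    rw [hp0, hpn] at this
    exact hnadj ((hH _ _).1 this).1
  have hmem : ∀ i, i ≤ n → p i ∈ T := by
    intro i hi
    rcases Nat.eq_zero_or_pos i with rfl | hpos
    · exact ((hH _ _).1 ((hadj 0 1 hi (by omega)).2 (by omega))).2.1
    · exact ((hH _ _).1 ((hadj i (i - 1) hi (by omega)).2 (by omega))).2.1
  have hint : ∀ i, i ≤ n → i ≠ 0 → i ≠ n → p i ≠ v ∧ ¬ G.Adj v (p i) := by
    intro i hi h0 h1
    rcases hT _ (hmem i hi) with h | h | h
    · exact absurd (hinj i 0 hi (by omega) (h.trans hp0.symm)) h0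
    · exact absurd (hinj i n hi le_rfl (h.trans hpn.symm)) h1
    · exact h
  refine hG (n + 2) (by omega) (exists_induced_cycle G n (by omega) p v hinj ?_ ?_ ?_)
  · intro i j hi hj
    rw [← hadj i j hi hj, hH]
    exact ⟨fun h => ⟨h, hmem i hi, hmem j hj⟩, fun h => h.1⟩
  · intro i hi
    by_cases h0 : i = 0
    · rw [h0, hp0]
      exact hvx.ne'
    by_cases h1 : i = n
    · rw [h1, hpn]
      exact hvy.ne'
    exact (hint i hi h0 h1).1
  · intro i hi
    constructor
    · intro h
      by_contra hc
      exact (hint i hi (by tauto) (by tauto)).2 h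
    · rintro (rfl | rfl)
      · rwa [hp0]
      · rwa [hpn]

/-- In a chordal graph, every vertex `v` of `S` that is not adjacent to all of `S` has a
non-neighbour which is simplicial in `S`. -/
theorem NoLongInducedCycle.exists_simplicial_not_adj {V : Type*} {G : SimpleGraph V}
    (hG : NoLongInducedCycle G) (S : Finset V) :
    ∀ v ∈ S, (∃ w ∈ S, w ≠ v ∧ ¬ G.Adj v w) →
      ∃ u ∈ S, u ≠ v ∧ ¬ G.Adj v u ∧ SimplicialIn G S u := by
  classical
  induction S using Finset.strongInduction with
  | H S ih =>
    rintro v hv ⟨c₀, hc₀S, hc₀v, hc₀⟩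
    set M : Set V := {t | t ∈ S ∧ t ≠ v ∧ ¬ G.Adj v t} with hM
    let R : SimpleGraph V :=
      { Adj := fun a b => G.Adj a b ∧ a ∈ M ∧ b ∈ M
        symm := ⟨fun a b h => ⟨h.1.symm, h.2.2, h.2.1⟩⟩
        loopless := ⟨fun a h => G.irrefl h.1⟩ }
    have hRM : ∀ c, R.Reachable c₀ c → c ∈ M := by
      intro c hc
      by_cases hcc : c = c₀
      · rw [hcc]
        exact ⟨hc₀S, hc₀v, hc₀⟩
      · obtain ⟨w⟩ := hc.symm
        cases w with
        | nil => exact absurd rfl hcc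
        | cons h _ => exact h.2.1
    let C : Finset V := S.filter fun c => R.Reachable c₀ c
    let X : Finset V := S.filter fun x => G.Adj v x ∧ ∃ c ∈ C, G.Adj c x
    have hCM : ∀ c ∈ C, c ∈ M := fun c hc => hRM c (Finset.mem_filter.1 hc).2
    have hXclique : ∀ x ∈ X, ∀ y ∈ X, x ≠ y → G.Adj x y := by
      intro x hx y hy hxy
      obtain ⟨hxS, hvx, c, hc, hcx⟩ := Finset.mem_filter.1 hx
      obtain ⟨hyS, hvy, d, hd, hdy⟩ := Finset.mem_filter.1 hy
      let T : Set V := {t | t = x ∨ t = y ∨ t ∈ M}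
      let H : SimpleGraph V :=
        { Adj := fun a b => G.Adj a b ∧ a ∈ T ∧ b ∈ T
          symm := ⟨fun a b h => ⟨h.1.symm, h.2.2, h.2.1⟩⟩
          loopless := ⟨fun a h => G.irrefl h.1⟩ }
      have hRH : R ≤ H := fun a b h => ⟨h.1, Or.inr (Or.inr h.2.1), Or.inr (Or.inr h.2.2)⟩
      have hcd : H.Reachable c d :=
        ((Finset.mem_filter.1 hc).2.symm.trans (Finset.mem_filter.1 hd).2).mono hRH
      have h1 : H.Adj x c := ⟨hcx.symm, Or.inl rfl, Or.inr (Or.inr (hCM c hc))⟩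
      have h2 : H.Adj d y := ⟨hdy, Or.inr (Or.inr (hCM d hd)), Or.inr (Or.inl rfl)⟩
      refine hG.adj_of_reachable hvx hvy hxy (T := T) (H := H) ?_ (fun a b => Iff.rfl)
        (h1.reachable.trans (hcd.trans h2.reachable))
      rintro t (h | h | h)
      · exact Or.inl h
      · exact Or.inr (Or.inl h)
      · exact Or.inr (Or.inr h.2)
    have hCnbr : ∀ c ∈ C, ∀ s ∈ S, G.Adj c s → s ∈ C ∪ X := by
      intro c hc s hs hcs
      rw [Finset.mem_union]
      by_cases hvs : G.Adj v s
      · exact Or.inr (Finset.mem_filter.2 ⟨hs, hvs, c, hc, hcs⟩)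
      · left
        have hsv : s ≠ v := by
          rintro rfl
          exact (hCM c hc).2.2 hcs.symm
        have : R.Adj c s := ⟨hcs, hCM c hc, hs, hsv, hvs⟩
        exact Finset.mem_filter.2 ⟨hs, (Finset.mem_filter.1 hc).2.trans this.reachable⟩
    have hc₀C : c₀ ∈ C := Finset.mem_filter.2 ⟨hc₀S, SimpleGraph.Reachable.refl _⟩
    have hsub : C ∪ X ⊂ S := by
      refine (Finset.ssubset_iff_of_subset ?_).2 ⟨v, hv, ?_⟩
      · exact Finset.union_subset (Finset.filter_subset _ _) (Finset.filter_subset _ _)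
      · intro h
        rcases Finset.mem_union.1 h with h | h
        · exact (hCM v h).2.1 rfl
        · exact G.irrefl (Finset.mem_filter.1 h).2.1
    suffices h : ∃ u ∈ C, SimplicialIn G (C ∪ X) u by
      obtain ⟨u, hu, hus⟩ := h
      refine ⟨u, (hCM u hu).1, (hCM u hu).2.1, (hCM u hu).2.2, ?_⟩
      intro a ha b hb hua hub hab
      exact hus a (hCnbr u hu a ha hua) b (hCnbr u hu b hb hub) hua hub hab
    have hX : (∃ x ∈ X, ∃ w ∈ C ∪ X, w ≠ x ∧ ¬ G.Adj x w) →
        ∃ u ∈ C, SimplicialIn G (C ∪ X) u := by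
      rintro ⟨x, hx, hw⟩
      obtain ⟨u, hu, hux, hxu, hus⟩ := ih _ hsub x (Finset.mem_union_right _ hx) hw
      rcases Finset.mem_union.1 hu with h | h
      · exact ⟨u, h, hus⟩
      · exact absurd (hXclique x hx u h hux.symm) hxu
    by_cases hall : ∃ a ∈ C ∪ X, ∃ w ∈ C ∪ X, w ≠ a ∧ ¬ G.Adj a w
    · obtain ⟨a, ha, hw⟩ := hall
      rcases Finset.mem_union.1 ha with haC | haX
      · obtain ⟨u, hu, hua, hau, hus⟩ := ih _ hsub a ha hw
        rcases Finset.mem_union.1 hu with h | h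
        · exact ⟨u, h, hus⟩
        · exact hX ⟨u, h, a, ha, hua.symm, fun h' => hau h'.symm⟩
      · exact hX ⟨a, haX, hw⟩
    · push Not at hall
      exact ⟨c₀, hc₀C, fun a ha b hb _ _ hab => hall a ha b hb hab.symm⟩

/-- Every nonempty vertex set of a chordal graph has a simplicial vertex (Dirac). -/
theorem NoLongInducedCycle.exists_simplicial {V : Type*} {G : SimpleGraph V}
    (hG : NoLongInducedCycle G) {S : Finset V} (hS : S.Nonempty) :
    ∃ u ∈ S, SimplicialIn G S u := by
  by_cases hall : ∃ a ∈ S, ∃ w ∈ S, w ≠ a ∧ ¬ G.Adj a w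
  · obtain ⟨a, ha, hw⟩ := hall
    obtain ⟨u, hu, -, -, hus⟩ := hG.exists_simplicial_not_adj S a ha hw
    exact ⟨u, hu, hus⟩
  · push Not at hall
    obtain ⟨u, hu⟩ := hS
    exact ⟨u, hu, fun a ha b hb _ _ hab => hall a ha b hb hab.symm⟩

/-- `r` ranks the vertices along a perfect elimination ordering of `G`. -/
def IsPerfectElimination {V : Type*} (G : SimpleGraph V) (r : V → ℕ) : Prop :=
  Function.Injective r ∧ ∀ u v w, r u < r v → r u < r w → G.Adj u v → G.Adj u w → v ≠ w →
    G.Adj v w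

/-- A finite chordal graph has a perfect elimination ordering. -/
theorem NoLongInducedCycle.exists_isPerfectElimination {V : Type*} [Fintype V]
    {G : SimpleGraph V} (hG : NoLongInducedCycle G) : ∃ r, IsPerfectElimination G r := by
  classical
  have key : ∀ S : Finset V, ∃ r : V → ℕ, (∀ u ∈ S, ∀ v ∈ S, r u = r v → u = v) ∧
      ∀ u ∈ S, ∀ v ∈ S, ∀ w ∈ S, r u < r v → r u < r w → G.Adj u v → G.Adj u w → v ≠ w →
        G.Adj v w := by
    intro S
    induction S using Finset.strongInduction with
    | H S ih =>
      rcases S.eq_empty_or_nonempty with rfl | hS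
      · exact ⟨fun _ => 0, by simp, by simp⟩
      obtain ⟨s, hs, hsimp⟩ := hG.exists_simplicial hS
      obtain ⟨r, hinj, hr⟩ := ih _ (Finset.erase_ssubset hs)
      refine ⟨fun v => if v = s then 0 else r v + 1, ?_, ?_⟩
      · intro u hu v hv huv
        dsimp only at huv
        split_ifs at huv with h1 h2 h2
        · rw [h1, h2]
        · exact hinj u (Finset.mem_erase.2 ⟨h1, hu⟩) v (Finset.mem_erase.2 ⟨h2, hv⟩) (by omega)
      · intro u hu v hv w hw huv huw auv auw hvw
        by_cases hus : u = s
        · subst hus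
          exact hsimp v hv w hw auv auw hvw
        · have hvs : v ≠ s := by
            rintro rfl
            simp at huv
          have hws : w ≠ s := by
            rintro rfl
            simp at huw
          simp only [hus, hvs, hws, if_false] at huv huw
          exact hr u (Finset.mem_erase.2 ⟨hus, hu⟩) v (Finset.mem_erase.2 ⟨hvs, hv⟩) w
            (Finset.mem_erase.2 ⟨hws, hw⟩) (by omega) (by omega) auv auw hvw
  obtain ⟨r, h1, h2⟩ := key Finset.univ
  exact ⟨r, fun u v => h1 u (Finset.mem_univ _) v (Finset.mem_univ _),
    fun u v w => h2 u (Finset.mem_univ _) v (Finset.mem_univ _) w (Finset.mem_univ _)⟩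

/-- `u` is a descendant of `y`: `y` is reached from `u` along edges of increasing rank. -/
def IsDescendant {V : Type*} (G : SimpleGraph V) (r : V → ℕ) (u y : V) : Prop :=
  Relation.ReflTransGen (fun a b => r a < r b ∧ G.Adj a b) u y

theorem IsDescendant.rank_le {V : Type*} {G : SimpleGraph V} {r : V → ℕ} {u y : V}
    (h : IsDescendant G r u y) : r u ≤ r y := by
  induction h with
  | refl => exact le_rfl
  | tail _ h ih => exact ih.trans h.1.le

/-- A later neighbour of a descendant of `y` is a descendant of `y` or a later neighbour
of `y`. -/
theorem IsPerfectElimination.later_neighbor {V : Type*} {G : SimpleGraph V} {r : V → ℕ}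
    (hr : IsPerfectElimination G r) {d y c : V} (hd : IsDescendant G r d y) (hdc : r d < r c)
    (hadj : G.Adj d c) : IsDescendant G r c y ∨ (r y < r c ∧ G.Adj y c) := by
  induction hd using Relation.ReflTransGen.head_induction_on with
  | refl => exact Or.inr ⟨hdc, hadj⟩
  | head h1 h2 ih =>
    rename_i a e
    by_cases hec : e = c
    · rw [← hec]
      exact Or.inl h2
    have hae : G.Adj e c := hr.2 a e c h1.1 hdc h1.2 hadj hec
    rcases lt_trichotomy (r e) (r c) with h | h | h
    · exact ih h hae
    · exact absurd (hr.1 h) hec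
    · exact Or.inl (Relation.ReflTransGen.head ⟨h, hae.symm⟩ h2)

/-- `C` contains all earlier neighbours of its members. -/
def DownClosed {V : Type*} (G : SimpleGraph V) (r : V → ℕ) (C : Finset V) : Prop :=
  ∀ v ∈ C, ∀ u, r u < r v → G.Adj u v → u ∈ C

theorem DownClosed.mem_of_isDescendant {V : Type*} {G : SimpleGraph V} {r : V → ℕ}
    {C : Finset V} (hC : DownClosed G r C) {u y : V} (hu : IsDescendant G r u y) (hy : y ∈ C) :
    u ∈ C := by
  induction hu using Relation.ReflTransGen.head_induction_on with
  | refl => exact hy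
  | head h1 _ ih => exact hC _ ih _ h1.1 h1.2

/-- `b` lies in the closed neighbourhood of `A`. -/
def DomBy {V : Type*} (G : SimpleGraph V) (A : Finset V) (b : V) : Prop :=
  ∃ a ∈ A, a = b ∨ G.Adj a b

theorem DomBy.mono {V : Type*} {G : SimpleGraph V} {A A' : Finset V} (h : A ⊆ A') {b : V}
    (hb : DomBy G A b) : DomBy G A' b := by
  obtain ⟨a, ha, hab⟩ := hb
  exact ⟨a, h ha, hab⟩

/-- `E` dominates `B ∩ C` from inside `C`. -/
def DominatesWithin {V : Type*} (G : SimpleGraph V) (B C E : Finset V) : Prop :=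
  E ⊆ C ∧ ∀ b ∈ B, b ∈ C → DomBy G E b

/-- `E` is a minimum set dominating `B ∩ C` from inside `C`, and it dominates every vertex of
`B` outside `C` that is dominated by some such minimum set. -/
def IsBestWithin {V : Type*} (G : SimpleGraph V) (B C E : Finset V) : Prop :=
  DominatesWithin G B C E ∧ ∀ E', DominatesWithin G B C E' → E.card ≤ E'.card ∧
    (E'.card = E.card → ∀ b ∈ B, b ∉ C → DomBy G E' b → DomBy G E b)

open Classical in
theorem IsBestWithin.union {V : Type*} {G : SimpleGraph V} {B C₁ C₂ E₁ E₂ : Finset V}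
    (h₁ : IsBestWithin G B C₁ E₁) (h₂ : IsBestWithin G B C₂ E₂) (hdisj : Disjoint C₁ C₂)
    (hno : ∀ a ∈ C₁, ∀ b ∈ C₂, ¬ G.Adj a b) : IsBestWithin G B (C₁ ∪ C₂) (E₁ ∪ E₂) := by
  refine ⟨⟨Finset.union_subset_union h₁.1.1 h₂.1.1, ?_⟩, ?_⟩
  · intro b hb hbC
    rcases Finset.mem_union.1 hbC with h | h
    · exact (h₁.1.2 b hb h).mono Finset.subset_union_left
    · exact (h₂.1.2 b hb h).mono Finset.subset_union_right
  · intro E' hE'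
    have hdisj' : ∀ a ∈ C₁, a ∉ C₂ := fun a ha hb => Finset.disjoint_left.1 hdisj ha hb
    have k₁ : DominatesWithin G B C₁ (E' ∩ C₁) := by
      refine ⟨Finset.inter_subset_right, fun b hb hbC => ?_⟩
      obtain ⟨a, ha, hab⟩ := hE'.2 b hb (Finset.mem_union_left _ hbC)
      refine ⟨a, Finset.mem_inter.2 ⟨ha, ?_⟩, hab⟩
      rcases hab with rfl | hab
      · exact hbC
      · rcases Finset.mem_union.1 (hE'.1 ha) with h | h
        · exact h
        · exact absurd hab.symm (hno b hbC a h)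
    have k₂ : DominatesWithin G B C₂ (E' ∩ C₂) := by
      refine ⟨Finset.inter_subset_right, fun b hb hbC => ?_⟩
      obtain ⟨a, ha, hab⟩ := hE'.2 b hb (Finset.mem_union_right _ hbC)
      refine ⟨a, Finset.mem_inter.2 ⟨ha, ?_⟩, hab⟩
      rcases hab with rfl | hab
      · exact hbC
      · rcases Finset.mem_union.1 (hE'.1 ha) with h | h
        · exact absurd hab (hno a h b hbC)
        · exact h
    have hcard : E'.card = (E' ∩ C₁).card + (E' ∩ C₂).card := by
      rw [← Finset.card_union_of_disjoint, ← Finset.inter_union_distrib_left,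
        Finset.inter_eq_left.2 hE'.1]
      exact hdisj.mono Finset.inter_subset_right Finset.inter_subset_right
    have hcard' : (E₁ ∪ E₂).card = E₁.card + E₂.card :=
      Finset.card_union_of_disjoint (hdisj.mono h₁.1.1 h₂.1.1)
    have l₁ := h₁.2 _ k₁
    have l₂ := h₂.2 _ k₂
    refine ⟨by omega, fun heq b hb hbC hdom => ?_⟩
    rw [Finset.mem_union, not_or] at hbC
    obtain ⟨a, ha, hab⟩ := hdom
    rcases Finset.mem_union.1 (hE'.1 ha) with h | h
    · exact (l₁.2 (by omega) b hb hbC.1 ⟨a, Finset.mem_inter.2 ⟨ha, h⟩, hab⟩).mono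
        Finset.subset_union_left
    · exact (l₂.2 (by omega) b hb hbC.2 ⟨a, Finset.mem_inter.2 ⟨ha, h⟩, hab⟩).mono
        Finset.subset_union_right

theorem exists_minimum_dominatesWithin {V : Type*} (G : SimpleGraph V) (B C : Finset V) :
    ∃ E, DominatesWithin G B C E ∧ ∀ E', DominatesWithin G B C E' → E.card ≤ E'.card := by
  classical
  have hne : (C.powerset.filter fun E => DominatesWithin G B C E).Nonempty :=
    ⟨C, Finset.mem_filter.2 ⟨Finset.mem_powerset_self C, Finset.Subset.refl C,
      fun b _ hb => ⟨b, hb, Or.inl rfl⟩⟩⟩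
  obtain ⟨E, hE, hmin⟩ := Finset.exists_min_image _ Finset.card hne
  exact ⟨E, (Finset.mem_filter.1 hE).2, fun E' hE' =>
    hmin E' (Finset.mem_filter.2 ⟨Finset.mem_powerset.2 hE'.1, hE'⟩)⟩

theorem IsPerfectElimination.exists_isBestWithin {V : Type*} {G : SimpleGraph V} {r : V → ℕ}
    (hr : IsPerfectElimination G r) (B C : Finset V) (hC : DownClosed G r C)
    (hB : ∀ v ∈ B, v ∈ C → ∀ b ∈ B, r v < r b → ¬ G.Adj v b) : ∃ E, IsBestWithin G B C E := by
  classical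
  induction C using Finset.strongInduction with
  | H C ih =>
    rcases C.eq_empty_or_nonempty with rfl | hne
    · refine ⟨∅, ⟨Finset.Subset.refl _, by simp⟩, fun E' hE' => ⟨by simp, ?_⟩⟩
      intro _ b _ _ hdom
      rwa [Finset.subset_empty.1 hE'.1] at hdom
    obtain ⟨y, hy, hmax⟩ := Finset.exists_max_image C r hne
    by_cases hall : ∀ c ∈ C, IsDescendant G r c y
    · have hout : ∀ e ∈ C, ∀ b, b ∉ C → (e = b ∨ G.Adj e b) → r y < r b ∧ G.Adj y b := by
        rintro e he b hb (rfl | heb)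
        · exact absurd he hb
        have hlt : r e < r b := by
          rcases lt_trichotomy (r e) (r b) with h | h | h
          · exact h
          · exact absurd (hr.1 h) heb.ne
          · exact absurd (hC e he b h heb.symm) hb
        rcases hr.later_neighbor (hall e he) hlt heb with h | h
        · exact absurd (hC.mem_of_isDescendant h hy) hb
        · exact h
      obtain ⟨E₀, hE₀, hmin⟩ := exists_minimum_dominatesWithin G B C
      by_cases hyB : y ∈ B
      · refine ⟨E₀, hE₀, fun E' hE' => ⟨hmin E' hE', ?_⟩⟩
        rintro - b hb hbC ⟨e, he, heb⟩
        have := hout e (hE'.1 he) b hbC heb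
        exact absurd this.2 (hB y hyB hy b hb this.1)
      by_cases hmem : ∃ E₁, DominatesWithin G B C E₁ ∧ E₁.card ≤ E₀.card ∧ y ∈ E₁
      · obtain ⟨E₁, hE₁, hcard, hyE₁⟩ := hmem
        refine ⟨E₁, hE₁, fun E' hE' => ⟨hcard.trans (hmin E' hE'), ?_⟩⟩
        rintro - b hb hbC ⟨e, he, heb⟩
        exact ⟨y, hyE₁, Or.inr (hout e (hE'.1 he) b hbC heb).2⟩
      · push Not at hmem
        have hsub : C.erase y ⊂ C := Finset.erase_ssubset hy
        obtain ⟨E, hE, hbest⟩ := ih _ hsub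
          (fun v hv u huv hadj => Finset.mem_erase.2 ⟨by
            rintro rfl
            exact absurd (hmax v (Finset.mem_of_mem_erase hv)) (by omega),
            hC v (Finset.mem_of_mem_erase hv) u huv hadj⟩)
          (fun v hv hvC => hB v hv (Finset.mem_of_mem_erase hvC))
        have htrans : ∀ E', DominatesWithin G B C E' → y ∉ E' →
            DominatesWithin G B (C.erase y) E' := fun E' hE' hyE' =>
          ⟨fun e he => Finset.mem_erase.2 ⟨fun h => hyE' (h ▸ he), hE'.1 he⟩,
            fun b hb hbC => hE'.2 b hb (Finset.mem_of_mem_erase hbC)⟩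
        have hEC : DominatesWithin G B C E :=
          ⟨hE.1.trans hsub.1, fun b hb hbC => hE.2 b hb
            (Finset.mem_erase.2 ⟨fun h => hyB (h ▸ hb), hbC⟩)⟩
        have hE₀y : y ∉ E₀ := hmem E₀ hE₀ le_rfl
        have hle := (hbest E₀ (htrans E₀ hE₀ hE₀y)).1
        refine ⟨E, hEC, fun E' hE' => ⟨hle.trans (hmin E' hE'), ?_⟩⟩
        intro heq b hb hbC hdom
        exact (hbest E' (htrans E' hE' (hmem E' hE' (by omega)))).2 heq b hb
          (fun h => hbC (Finset.mem_of_mem_erase h)) hdom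
    · push Not at hall
      obtain ⟨c₀, hc₀, hc₀y⟩ := hall
      set C₁ := C.filter fun c => IsDescendant G r c y with hC₁
      set C₂ := C.filter fun c => ¬ IsDescendant G r c y with hC₂
      have hno : ∀ a ∈ C₁, ∀ b ∈ C₂, ¬ G.Adj a b := by
        intro a ha b hb hab
        obtain ⟨haC, hay⟩ := Finset.mem_filter.1 ha
        obtain ⟨hbC, hby⟩ := Finset.mem_filter.1 hb
        rcases lt_trichotomy (r a) (r b) with h | h | h
        · rcases hr.later_neighbor hay h hab with h' | h'
          · exact hby h'
          · exact absurd (hmax b hbC) (by omega)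
        · exact hab.ne (hr.1 h)
        · exact hby (Relation.ReflTransGen.head ⟨h, hab.symm⟩ hay)
      have hunion : C₁ ∪ C₂ = C := Finset.filter_union_filter_not_eq _ _
      have hdisj : Disjoint C₁ C₂ := Finset.disjoint_filter_filter_not _ _ _
      have hs₁ : C₁ ⊂ C := Finset.filter_ssubset.2 ⟨c₀, hc₀, hc₀y⟩
      have hs₂ : C₂ ⊂ C :=
        Finset.filter_ssubset.2 ⟨y, hy, fun h => h Relation.ReflTransGen.refl⟩
      obtain ⟨E₁, hE₁⟩ := ih C₁ hs₁
        (fun v hv u huv hadj => Finset.mem_filter.2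
          ⟨hC v (hs₁.1 hv) u huv hadj,
            Relation.ReflTransGen.head ⟨huv, hadj⟩ (Finset.mem_filter.1 hv).2⟩)
        (fun v hv hvC => hB v hv (hs₁.1 hvC))
      obtain ⟨E₂, hE₂⟩ := ih C₂ hs₂
        (fun v hv u huv hadj => by
          have huC := hC v (hs₂.1 hv) u huv hadj
          refine Finset.mem_filter.2 ⟨huC, fun hu => ?_⟩
          exact hno u (Finset.mem_filter.2 ⟨huC, hu⟩) v hv hadj)
        (fun v hv hvC => hB v hv (hs₂.1 hvC))
      exact ⟨E₁ ∪ E₂, hunion ▸ hE₁.union hE₂ hdisj hno⟩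

/-- If deleting any vertex from `B` lowers the number of vertices needed to dominate it, then
`B` is independent. -/
theorem IsPerfectElimination.indepIn_of_critical {V : Type*} [Fintype V] {G : SimpleGraph V}
    {r : V → ℕ} (hr : IsPerfectElimination G r) (B : Finset V) (k : ℕ)
    (hk : ∀ D, (∀ b ∈ B, DomBy G D b) → k ≤ D.card)
    (hcrit : ∀ b ∈ B, ∃ D : Finset V, D.card < k ∧ ∀ c ∈ B, c ≠ b → DomBy G D c) :
    IndepIn G B := by
  classical
  by_contra hind
  have hne : (B.filter fun b => ∃ c ∈ B, r b < r c ∧ G.Adj b c).Nonempty := by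
    unfold IndepIn at hind
    push Not at hind
    obtain ⟨x, hx, y, hy, hxy⟩ := hind
    rcases lt_trichotomy (r x) (r y) with h | h | h
    · exact ⟨x, Finset.mem_filter.2 ⟨hx, y, hy, h, hxy⟩⟩
    · exact absurd (hr.1 h) hxy.ne
    · exact ⟨y, Finset.mem_filter.2 ⟨hy, x, hx, h, hxy.symm⟩⟩
  obtain ⟨b₁, hb₁', hfirst⟩ := Finset.exists_min_image _ r hne
  obtain ⟨hb₁, b₂, hb₂, hlt, hadj⟩ := Finset.mem_filter.1 hb₁'
  set C : Finset V := Finset.univ.filter fun c => IsDescendant G r c b₁ ∧ c ≠ b₁ with hCdef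
  have memC : ∀ c, c ∈ C ↔ IsDescendant G r c b₁ ∧ c ≠ b₁ := by simp [hCdef]
  have hCrank : ∀ c ∈ C, r c < r b₁ := fun c hc =>
    lt_of_le_of_ne ((memC c).1 hc).1.rank_le fun h => ((memC c).1 hc).2 (hr.1 h)
  have hC : DownClosed G r C := by
    intro v hv u huv huvadj
    refine (memC u).2 ⟨Relation.ReflTransGen.head ⟨huv, huvadj⟩ ((memC v).1 hv).1, ?_⟩
    rintro rfl
    exact absurd (hCrank v hv) (by omega)
  have hb₁C : b₁ ∉ C := fun h => ((memC b₁).1 h).2 rfl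
  have hout : ∀ c ∈ C, ∀ e, e ∉ C → G.Adj c e → e = b₁ ∨ (r b₁ < r e ∧ G.Adj b₁ e) := by
    intro c hc e he hce
    have hlt : r c < r e := by
      rcases lt_trichotomy (r c) (r e) with h | h | h
      · exact h
      · exact absurd (hr.1 h) hce.ne
      · exact absurd (hC c hc e h hce.symm) he
    rcases hr.later_neighbor ((memC c).1 hc).1 hlt hce with h | h
    · left
      by_contra hne
      exact he ((memC e).2 ⟨h, hne⟩)
    · exact Or.inr h
  obtain ⟨E, hE, hbest⟩ := hr.exists_isBestWithin B C hC (by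
    intro v hv hvC b hb hvb hvbadj
    have := hfirst v (Finset.mem_filter.2 ⟨hv, b, hb, hvb, hvbadj⟩)
    exact absurd (hCrank v hvC) (by omega))
  obtain ⟨D₁, hD₁card, hD₁⟩ := hcrit b₁ hb₁
  obtain ⟨D₂, hD₂card, hD₂⟩ := hcrit b₂ hb₂
  have hne12 : b₁ ≠ b₂ := hadj.ne
  have hD₁b : ¬ DomBy G D₁ b₁ := by
    intro h
    refine absurd (hk D₁ fun b hb => ?_) (by omega)
    by_cases hbb : b = b₁
    · rwa [hbb]
    · exact hD₁ b hb hbb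
  have hD₂b : ¬ DomBy G D₂ b₂ := by
    intro h
    refine absurd (hk D₂ fun b hb => ?_) (by omega)
    by_cases hbb : b = b₂
    · rwa [hbb]
    · exact hD₂ b hb hbb
  have havoid₁ : ∀ e ∈ D₁, ¬ (e = b₁ ∨ (r b₁ < r e ∧ G.Adj b₁ e)) := by
    rintro e he (h | h)
    · exact hD₁b ⟨e, he, Or.inl h⟩
    · exact hD₁b ⟨e, he, Or.inr h.2.symm⟩
  have havoid₂ : ∀ e ∈ D₂, ¬ (e = b₁ ∨ (r b₁ < r e ∧ G.Adj b₁ e)) := by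
    rintro e he (rfl | h)
    · exact hD₂b ⟨e, he, Or.inr hadj⟩
    · by_cases heb : e = b₂
      · exact hD₂b ⟨e, he, Or.inl heb⟩
      · exact hD₂b ⟨e, he, Or.inr (hr.2 b₁ e b₂ h.1 hlt h.2 hadj heb)⟩
  have hwithin : ∀ D : Finset V, (∀ e ∈ D, ¬ (e = b₁ ∨ (r b₁ < r e ∧ G.Adj b₁ e))) →
      (∀ b ∈ B, b ∈ C → DomBy G D b) → DominatesWithin G B C (D ∩ C) := by
    intro D hD hdom
    refine ⟨Finset.inter_subset_right, fun b hb hbC => ?_⟩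
    obtain ⟨e, he, heb⟩ := hdom b hb hbC
    refine ⟨e, Finset.mem_inter.2 ⟨he, ?_⟩, heb⟩
    by_contra heC
    rcases heb with rfl | heb
    · exact heC hbC
    · exact hD e he (hout b hbC e heC heb.symm)
  have hw₁ := hwithin D₁ havoid₁ fun b hb hbC => hD₁ b hb fun h => hb₁C (h ▸ hbC)
  have hw₂ := hwithin D₂ havoid₂ fun b hb hbC => hD₂ b hb fun h => by
    have := hCrank b hbC
    rw [h] at this
    omega
  have hequal : ∀ D : Finset V, D.card < k → DominatesWithin G B C (D ∩ C) →
      (∀ b ∈ B, b ≠ b₁ → ¬ G.Adj b₁ b → DomBy G D b) → (D ∩ C).card = E.card := by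
    intro D hDk hDw hdom
    refine le_antisymm ?_ (hbest _ hDw).1
    by_contra! hcon
    have hcard : (insert b₁ ((D \ C) ∪ E)).card < k := by
      have h1 := Finset.card_insert_le b₁ ((D \ C) ∪ E)
      have h2 := Finset.card_union_le (D \ C) E
      have h3 := Finset.card_sdiff_add_card_inter D C
      omega
    refine absurd (hk _ fun b hb => ?_) (not_le.2 hcard)
    by_cases hbC : b ∈ C
    · exact (hE.2 b hb hbC).mono
        (Finset.subset_union_right.trans (Finset.subset_insert _ _))
    by_cases hbb : b = b₁
    · exact ⟨b₁, Finset.mem_insert_self _ _, Or.inl hbb.symm⟩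
    by_cases hbadj : G.Adj b₁ b
    · exact ⟨b₁, Finset.mem_insert_self _ _, Or.inr hbadj⟩
    obtain ⟨e, he, heb⟩ := hdom b hb hbb hbadj
    by_cases heC : e ∈ C
    · rcases heb with rfl | heb
      · exact absurd heC hbC
      · rcases hout e heC b hbC heb with h | h
        · exact absurd h hbb
        · exact absurd h.2 hbadj
    · exact ⟨e, Finset.mem_insert_of_mem (Finset.mem_union_left _
        (Finset.mem_sdiff.2 ⟨he, heC⟩)), heb⟩
  have he₁ := hequal D₁ hD₁card hw₁ fun b hb hbb _ => hD₁ b hb hbb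
  have he₂ := hequal D₂ hD₂card hw₂ fun b hb _ hbadj => hD₂ b hb fun h => hbadj (h ▸ hadj)
  have hEb₁ : DomBy G E b₁ := by
    refine (hbest _ hw₂).2 he₂ b₁ hb₁ hb₁C ?_
    obtain ⟨d, hd, hdb⟩ := hD₂ b₁ hb₁ hne12
    refine ⟨d, Finset.mem_inter.2 ⟨hd, ?_⟩, hdb⟩
    have hav := havoid₂ d hd
    rcases hdb with h | h
    · exact absurd (Or.inl h) hav
    · rcases lt_trichotomy (r d) (r b₁) with h' | h' | h'
      · exact (memC d).2 ⟨Relation.ReflTransGen.single ⟨h', h⟩, h.ne⟩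
      · exact absurd (hr.1 h') h.ne
      · exact absurd (Or.inr ⟨h', h.symm⟩) hav
  have hcard : ((D₁ \ C) ∪ E).card < k := by
    have h2 := Finset.card_union_le (D₁ \ C) E
    have h3 := Finset.card_sdiff_add_card_inter D₁ C
    omega
  refine absurd (hk _ fun b hb => ?_) (not_le.2 hcard)
  by_cases hbb : b = b₁
  · rw [hbb]
    exact hEb₁.mono Finset.subset_union_right
  by_cases hbC : b ∈ C
  · exact (hE.2 b hb hbC).mono Finset.subset_union_right
  obtain ⟨e, he, heb⟩ := hD₁ b hb hbb
  by_cases heC : e ∈ C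
  · exact ((hbest _ hw₁).2 he₁ b hb hbC ⟨e, Finset.mem_inter.2 ⟨he, heC⟩, heb⟩).mono
      Finset.subset_union_right
  · exact ⟨e, Finset.mem_union_left _ (Finset.mem_sdiff.2 ⟨he, heC⟩), heb⟩

theorem domNum_le_card {V : Type*} {G : SimpleGraph V} {A B : Finset V}
    (h : Dominates G A B) : domNum G B ≤ A.card :=
  Nat.sInf_le ⟨A, rfl, h⟩

theorem exists_card_eq_domNum {V : Type*} (G : SimpleGraph V) (B : Finset V) :
    ∃ A : Finset V, A.card = domNum G B ∧ Dominates G A B :=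
  Nat.sInf_mem (s := {n | ∃ A : Finset V, A.card = n ∧ Dominates G A B})
    ⟨B.card, B, rfl, fun b hb => ⟨b, hb, Or.inl rfl⟩⟩

theorem domNum_mono {V : Type*} (G : SimpleGraph V) {B B' : Finset V} (h : B ⊆ B') :
    domNum G B ≤ domNum G B' := by
  obtain ⟨A, hA, hdom⟩ := exists_card_eq_domNum G B'
  rw [← hA]
  exact domNum_le_card fun b hb => hdom b (h hb)

/-- For finite chordal graphs (no induced cycle of length at least four),
`γ(G) = γ^i(G)`. -/
theorem gamma_eq_gammaI_of_chordal {V : Type*} [Fintype V] (G : SimpleGraph V)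
    (hchordal : ∀ n : ℕ, 4 ≤ n → ¬ ∃ f : Fin n ↪ V, ∀ a b : Fin n,
      G.Adj (f a) (f b) ↔ (SimpleGraph.cycleGraph n).Adj a b) :
    gamma G = gammaI G := by
  classical
  obtain ⟨r, hr⟩ := NoLongInducedCycle.exists_isPerfectElimination (G := G) hchordal
  have hne : (Finset.univ.filter fun B : Finset V => domNum G B = gamma G).Nonempty :=
    ⟨Finset.univ, Finset.mem_filter.2 ⟨Finset.mem_univ _, rfl⟩⟩
  obtain ⟨B, hB', hmin⟩ := Finset.exists_min_image _ Finset.card hne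
  have hB : domNum G B = gamma G := (Finset.mem_filter.1 hB').2
  have hbound : ∀ A : Finset V, domNum G A ≤ gamma G := fun A =>
    domNum_mono G (Finset.subset_univ A)
  have hind : IndepIn G B := by
    refine hr.indepIn_of_critical B (gamma G) (fun D hD => hB ▸ domNum_le_card hD) ?_
    intro b hb
    obtain ⟨D, hD, hdom⟩ := exists_card_eq_domNum G (B.erase b)
    refine ⟨D, ?_, fun c hc hcb => hdom c (Finset.mem_erase.2 ⟨hcb, hc⟩)⟩
    rw [hD]
    refine lt_of_le_of_ne (hbound _) fun heq => ?_
    have h1 := hmin _ (Finset.mem_filter.2 ⟨Finset.mem_univ _, heq⟩)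
    have h2 := Finset.card_erase_lt_of_mem hb
    omega
  have hgreatest : IsGreatest {n | ∃ A : Finset V, IndepIn G A ∧ domNum G A = n} (gamma G) := by
    refine ⟨⟨B, hind, hB⟩, ?_⟩
    rintro n ⟨A, -, rfl⟩
    exact hbound A
  exact hgreatest.csSup_eq.symm
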